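/- arXiv:0903.1496 — 2 statements merged into one kernel-verified Lean document; each statement's English description precedes it below -/
import Mathlib

section
/- For each fixed ζ ∈ [0, 1/4), both information measures of the hidden SFCAR model grow like (1/2)·log SNR at high SNR; precisely, lim_{SNR→∞} [ 𝒦ₛ(SNR, ζ) − (1/2)·log SNR ] = L_ζ − 1/2 and lim_{SNR→∞} [ ℐₛ(SNR, ζ) − (1/2)·log SNR ] = L_ζ, where L_ζ = (1/(4π²)) ∫_{−π}^{π} ∫_{−π}^{π} (1/2)·log G_ζ(ω₁,ω₂) dω₁ dω₂ is finite. -/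
open Real MeasureTheory Filter

/-- The complete elliptic integral of the first kind,
`K(k) = ∫₀^{π/2} (1 - k² sin²θ)^{-1/2} dθ`. -/
noncomputable def ellipticK (k : ℝ) : ℝ :=
  ∫ t in (0 : ℝ)..(π / 2), (1 - k ^ 2 * Real.sin t ^ 2) ^ (-(1 / 2) : ℝ)

/-- `D_ζ(ω₁,ω₂) = 1 − 2ζ cos ω₁ − 2ζ cos ω₂`. -/
noncomputable def Dz (ζ ω₁ ω₂ : ℝ) : ℝ :=
  1 - 2 * ζ * Real.cos ω₁ - 2 * ζ * Real.cos ω₂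

/-- `G_ζ(ω₁,ω₂) = 1/((2/π) K(4ζ) D_ζ(ω₁,ω₂))`. -/
noncomputable def Gz (ζ ω₁ ω₂ : ℝ) : ℝ :=
  1 / ((2 / π) * ellipticK (4 * ζ) * Dz ζ ω₁ ω₂)

/-- Asymptotic per-node Kullback–Leibler information `𝒦ₛ(SNR, ζ)` of the hidden
SFCAR model. -/
noncomputable def Ks (snr ζ : ℝ) : ℝ :=
  (1 / (4 * π ^ 2)) * ∫ ω₁ in (-π)..π, ∫ ω₂ in (-π)..π,
    ((1 / 2) * Real.log (1 + snr * Gz ζ ω₁ ω₂) -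
      (1 / 2) * (1 - 1 / (1 + snr * Gz ζ ω₁ ω₂)))

/-- Asymptotic per-node mutual information `ℐₛ(SNR, ζ)` of the hidden SFCAR
model. -/
noncomputable def Is (snr ζ : ℝ) : ℝ :=
  (1 / (4 * π ^ 2)) * ∫ ω₁ in (-π)..π, ∫ ω₂ in (-π)..π,
    (1 / 2) * Real.log (1 + snr * Gz ζ ω₁ ω₂)

lemma key_tendsto (F : ℝ → ℝ → ℝ → ℝ) (f : ℝ → ℝ → ℝ) (C c : ℝ) (l : ℝ → ℝ)
    (hF : ∀ s > 0, Continuous (Function.uncurry (F s))) (hf : Continuous (Function.uncurry f))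
    (h : ∀ s > 0, ∀ x y, |F s x y - l s - (f x y - c)| ≤ C / s) :
    Tendsto (fun s => (1 / (4 * π ^ 2)) * (∫ x in (-π)..π, ∫ y in (-π)..π, F s x y) - l s) atTop
      (nhds ((1 / (4 * π ^ 2)) * (∫ x in (-π)..π, ∫ y in (-π)..π, f x y) - c)) := by
  have inner : ∀ g : ℝ → ℝ → ℝ, Continuous (Function.uncurry g) →
      Continuous (fun x => ∫ y in (-π)..π, g x y) := fun g hg =>
    intervalIntegral.continuous_parametric_intervalIntegral_of_continuous' hg _ _
  rw [tendsto_iff_norm_sub_tendsto_zero]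
  have hlim : Tendsto (fun s : ℝ => C / s) atTop (nhds 0) := tendsto_const_nhds.div_atTop tendsto_id
  refine squeeze_zero' (Eventually.of_forall fun _ => norm_nonneg _) ?_ hlim
  filter_upwards [eventually_gt_atTop 0] with s hs
  have h1 : (∫ x in (-π)..π, ∫ y in (-π)..π, (F s x y - l s - (f x y - c)))
      = (∫ x in (-π)..π, ∫ y in (-π)..π, F s x y) - (∫ x in (-π)..π, ∫ y in (-π)..π, f x y)
        - 4 * π ^ 2 * (l s - c) := by
    have e : ∀ x, (∫ y in (-π)..π, (F s x y - l s - (f x y - c)))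
        = (∫ y in (-π)..π, F s x y) - (∫ y in (-π)..π, f x y) - 2 * π * (l s - c) := by
      intro x
      have a1 : Continuous (fun y => F s x y) := (hF s hs).comp (by fun_prop : Continuous fun y : ℝ => (x, y))
      have a2 : Continuous (fun y => f x y) := hf.comp (by fun_prop : Continuous fun y : ℝ => (x, y))
      have a3 : Continuous (fun y => F s x y - f x y) := a1.sub a2
      have e1 : (fun y => F s x y - l s - (f x y - c)) = fun y => F s x y - f x y - (l s - c) := by
        funext y; ring
      rw [e1, intervalIntegral.integral_sub (a3.intervalIntegrable _ _) (continuous_const.intervalIntegrable _ _),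
        intervalIntegral.integral_sub (a1.intervalIntegrable _ _) (a2.intervalIntegrable _ _),
        intervalIntegral.integral_const, smul_eq_mul]
      ring
    simp_rw [e]
    have a1 := inner _ (hF s hs)
    have a2 := inner _ hf
    have a3 : Continuous (fun x => (∫ y in (-π)..π, F s x y) - ∫ y in (-π)..π, f x y) := a1.sub a2
    rw [intervalIntegral.integral_sub (a3.intervalIntegrable _ _) (continuous_const.intervalIntegrable _ _),
        intervalIntegral.integral_sub (a1.intervalIntegrable _ _) (a2.intervalIntegrable _ _),
        intervalIntegral.integral_const, smul_eq_mul]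
    ring
  have h2 : ‖∫ x in (-π)..π, ∫ y in (-π)..π, (F s x y - l s - (f x y - c))‖
      ≤ (C / s * |π - -π|) * |π - -π| := by
    refine intervalIntegral.norm_integral_le_of_norm_le_const fun x _ => ?_
    exact intervalIntegral.norm_integral_le_of_norm_le_const fun y _ => h s hs x y
  have hpi := Real.pi_pos
  have e3 : |π - -π| = 2 * π := by rw [abs_of_pos] <;> linarith
  rw [h1, e3] at h2
  set A := ∫ x in (-π)..π, ∫ y in (-π)..π, F s x y
  set B := ∫ x in (-π)..π, ∫ y in (-π)..π, f x y
  have e4 : (1 / (4 * π ^ 2)) * A - l s - ((1 / (4 * π ^ 2)) * B - c)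
      = (1 / (4 * π ^ 2)) * (A - B - 4 * π ^ 2 * (l s - c)) := by
    field_simp
    ring
  rw [e4, norm_mul, Real.norm_of_nonneg (by positivity)]
  calc _ ≤ (1 / (4 * π ^ 2)) * ((C / s * (2 * π)) * (2 * π)) := by gcongr
    _ = C / s := by field_simp; ring

lemma ellipticK_pos' (k : ℝ) (h0 : 0 ≤ k) (h1 : k < 1) : 0 < ellipticK k := by
  have hp : ∀ t : ℝ, 0 < 1 - k ^ 2 * Real.sin t ^ 2 := fun t => by
    nlinarith [Real.sin_sq_le_one t, sq_nonneg (Real.sin t), mul_le_mul_of_nonneg_left (Real.sin_sq_le_one t) (sq_nonneg k)]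
  have hc : Continuous fun t : ℝ => (1 - k ^ 2 * Real.sin t ^ 2) ^ (-(1 / 2) : ℝ) :=
    Continuous.rpow_const (by fun_prop) fun t => Or.inl (hp t).ne'
  exact intervalIntegral.intervalIntegral_pos_of_pos (hc.intervalIntegrable _ _)
    (fun t => Real.rpow_pos_of_pos (hp t) _) (by positivity)

lemma Dz_bounds (ζ : ℝ) (hζ : ζ ∈ Set.Ico (0 : ℝ) (1 / 4)) (x y : ℝ) :
    0 < Dz ζ x y ∧ Dz ζ x y ≤ 2 := by
  obtain ⟨h0, h1⟩ := hζ
  unfold Dz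
  have a1 := mul_le_mul_of_nonneg_left (Real.cos_le_one x) h0
  have a2 := mul_le_mul_of_nonneg_left (Real.cos_le_one y) h0
  have a3 := mul_le_mul_of_nonneg_left (Real.neg_one_le_cos x) h0
  have a4 := mul_le_mul_of_nonneg_left (Real.neg_one_le_cos y) h0
  constructor <;> linarith

lemma pt_bound (s G M : ℝ) (hs : 0 < s) (hG : 0 < G) (hM : 1 / G ≤ M) :
    (0 ≤ Real.log (1 + s * G) - Real.log s - Real.log G ∧
      Real.log (1 + s * G) - Real.log s - Real.log G ≤ M / s) ∧
    (0 ≤ 1 / (1 + s * G) ∧ 1 / (1 + s * G) ≤ M / s) := by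
  have hsG : 0 < s * G := mul_pos hs hG
  have b : 1 / (s * G) ≤ M / s := by
    have : 1 / (s * G) = (1 / G) / s := by field_simp
    rw [this]; gcongr
  have e : Real.log (1 + s * G) - Real.log s - Real.log G = Real.log (1 + 1 / (s * G)) := by
    rw [sub_sub, ← Real.log_mul hs.ne' hG.ne', ← Real.log_div (by positivity) hsG.ne']
    congr 1
    field_simp
    ring
  have hq : 0 < 1 / (s * G) := by positivity
  refine ⟨⟨?_, ?_⟩, by positivity, le_trans ?_ b⟩
  · rw [e]; exact Real.log_nonneg (by linarith)
  · rw [e]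
    have := Real.log_le_sub_one_of_pos (by linarith : 0 < 1 + 1 / (s * G))
    linarith
  · exact one_div_le_one_div_of_le hsG (by linarith)

/-- High-SNR behavior: for fixed `ζ ∈ [0,1/4)` both information measures of the
hidden SFCAR model grow like `(1/2) log SNR`, with limiting offsets `L_ζ − 1/2`
and `L_ζ`, where `L_ζ = (1/(4π²)) ∬ (1/2) log G_ζ`. -/
theorem SFCAR_info_high_SNR (ζ : ℝ) (hζ : ζ ∈ Set.Ico (0 : ℝ) (1 / 4)) :
    Tendsto (fun snr : ℝ => Ks snr ζ - (1 / 2) * Real.log snr) atTop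
      (nhds ((1 / (4 * π ^ 2)) * (∫ ω₁ in (-π)..π, ∫ ω₂ in (-π)..π,
        (1 / 2) * Real.log (Gz ζ ω₁ ω₂)) - 1 / 2)) ∧
    Tendsto (fun snr : ℝ => Is snr ζ - (1 / 2) * Real.log snr) atTop
      (nhds ((1 / (4 * π ^ 2)) * ∫ ω₁ in (-π)..π, ∫ ω₂ in (-π)..π,
        (1 / 2) * Real.log (Gz ζ ω₁ ω₂))) := by
  have hK : 0 < ellipticK (4 * ζ) := ellipticK_pos' _ (by linarith [hζ.1]) (by linarith [hζ.2])
  have hpi := Real.pi_pos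
  have hD := Dz_bounds ζ hζ
  have hden : ∀ x y, 0 < (2 / π) * ellipticK (4 * ζ) * Dz ζ x y := fun x y =>
    mul_pos (by positivity) (hD x y).1
  have hG : ∀ x y, 0 < Gz ζ x y := fun x y => one_div_pos.mpr (hden x y)
  have hM : ∀ x y, 1 / Gz ζ x y ≤ (2 / π) * ellipticK (4 * ζ) * 2 := fun x y => by
    unfold Gz
    rw [one_div_one_div]
    exact mul_le_mul_of_nonneg_left (hD x y).2 (by positivity)
  have hGc : Continuous fun p : ℝ × ℝ => Gz ζ p.1 p.2 := by
    unfold Gz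
    refine Continuous.div continuous_const ?_ fun p => (hden p.1 p.2).ne'
    unfold Dz
    fun_prop
  have hp1 : ∀ s > 0, ∀ p : ℝ × ℝ, 1 + s * Gz ζ p.1 p.2 ≠ 0 := fun s hs p => by
    have := mul_pos hs (hG p.1 p.2)
    positivity
  have hlogc : Continuous fun p : ℝ × ℝ => (1 / 2) * Real.log (Gz ζ p.1 p.2) :=
    continuous_const.mul (hGc.log fun p => (hG p.1 p.2).ne')
  have hlc : ∀ s > 0, Continuous fun p : ℝ × ℝ => (1 / 2) * Real.log (1 + s * Gz ζ p.1 p.2) :=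
    fun s hs => continuous_const.mul
      ((continuous_const.add (continuous_const.mul hGc)).log (hp1 s hs))
  have hrc : ∀ s > 0, Continuous fun p : ℝ × ℝ =>
      (1 / 2) * (1 - 1 / (1 + s * Gz ζ p.1 p.2)) :=
    fun s hs => continuous_const.mul (continuous_const.sub (continuous_const.div
      (continuous_const.add (continuous_const.mul hGc)) (hp1 s hs)))
  constructor
  · refine key_tendsto (fun s x y => (1 / 2) * Real.log (1 + s * Gz ζ x y) -
      (1 / 2) * (1 - 1 / (1 + s * Gz ζ x y))) (fun x y => (1 / 2) * Real.log (Gz ζ x y))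
      ((2 / π) * ellipticK (4 * ζ) * 2) (1 / 2) (fun s => (1 / 2) * Real.log s)
      (fun s hs => (hlc s hs).sub (hrc s hs)) hlogc ?_
    intro s hs x y
    obtain ⟨⟨h1, h2⟩, h3, h4⟩ := pt_bound s _ _ hs (hG x y) (hM x y)
    rw [abs_le]
    constructor <;> linarith
  · have := key_tendsto (fun s x y => (1 / 2) * Real.log (1 + s * Gz ζ x y))
      (fun x y => (1 / 2) * Real.log (Gz ζ x y))
      ((2 / π) * ellipticK (4 * ζ) * 2) 0 (fun s => (1 / 2) * Real.log s)
      hlc hlogc ?_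
    · rw [sub_zero] at this
      exact this
    intro s hs x y
    obtain ⟨⟨h1, h2⟩, h3, h4⟩ := pt_bound s _ _ hs (hG x y) (hM x y)
    rw [abs_le]
    constructor <;> linarith
end

section
/- For an ad hoc sensor network with fixed node density and fixed per-node sensing energy, the total information scales as Θ(E_t^{2/3}) in the total consumed energy: there exist constants c₁, c₂ > 0 and N such that for all n ≥ N, c₁ · E_t(n)^{2/3} ≤ I_t(n) ≤ c₂ · E_t(n)^{2/3}, and E_t(n) → ∞ as n → ∞. -/
open Filter

lemma aux_tri (m : ℕ) : 2 * ∑ i ∈ Finset.range m, ((m : ℤ) - i) = m * (m + 1) := by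
  induction m with
  | zero => simp
  | succ k ih =>
    have h : ∑ i ∈ Finset.range k, (((k + 1 : ℕ) : ℤ) - i)
        = ∑ i ∈ Finset.range k, ((k : ℤ) - i) + k := by
      have : ∀ i ∈ Finset.range k, (((k + 1 : ℕ) : ℤ) - i) = ((k : ℤ) - i) + 1 := by
        intro i _; push_cast; ring
      rw [Finset.sum_congr rfl this, Finset.sum_add_distrib]; simp
    rw [Finset.sum_range_succ, h]
    push_cast
    linarith

lemma aux_lower (n m : ℕ) (h : m ≤ n) :
    (m : ℤ) * (m + 1) ≤ 2 * ∑ i ∈ Finset.range n, |(i : ℤ) - (m : ℤ)| := by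
  rw [← aux_tri]
  have h1 : ∑ i ∈ Finset.range m, ((m : ℤ) - i) ≤ ∑ i ∈ Finset.range m, |(i : ℤ) - (m : ℤ)| :=
    Finset.sum_le_sum fun i _ => by rw [abs_sub_comm]; exact le_abs_self _
  have h2 : ∑ i ∈ Finset.range m, |(i : ℤ) - (m : ℤ)|
      ≤ ∑ i ∈ Finset.range n, |(i : ℤ) - (m : ℤ)| :=
    Finset.sum_le_sum_of_subset_of_nonneg (Finset.range_mono h) fun i _ _ => abs_nonneg _
  linarith

lemma aux_upper (n m : ℕ) (h : m ≤ n) :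
    ∑ i ∈ Finset.range n, |(i : ℤ) - (m : ℤ)| ≤ n * n := by
  have : ∑ i ∈ Finset.range n, |(i : ℤ) - (m : ℤ)| ≤ ∑ i ∈ Finset.range n, (n : ℤ) :=
    Finset.sum_le_sum fun i hi => by
      have := Finset.mem_range.mp hi
      rw [abs_le]; constructor <;> omega
  simpa using this

lemma aux_sum (n m : ℕ) :
    (∑ i ∈ Finset.range n, ∑ j ∈ Finset.range n, (|(i : ℤ) - (m : ℤ)| + |(j : ℤ) - (m : ℤ)|) : ℤ)
      = 2 * n * ∑ i ∈ Finset.range n, |(i : ℤ) - (m : ℤ)| := by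
  simp only [Finset.sum_add_distrib, Finset.sum_const, Finset.card_range, nsmul_eq_mul,
    ← Finset.mul_sum]
  ring

lemma aux_bounds (n : ℕ) (hn : 2 ≤ n) :
    (n : ℤ) ^ 3 ≤ 8 * (2 * n * ∑ i ∈ Finset.range n, |(i : ℤ) - ((n / 2 : ℕ) : ℤ)|) ∧
    (2 * n * ∑ i ∈ Finset.range n, |(i : ℤ) - ((n / 2 : ℕ) : ℤ)|) ≤ 2 * (n : ℤ) ^ 3 := by
  have h1 := aux_lower n (n / 2) (Nat.div_le_self _ _)
  have h2 := aux_upper n (n / 2) (Nat.div_le_self _ _)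
  have h3 : (n : ℤ) ≤ 2 * ((n / 2 : ℕ) : ℤ) + 1 := by omega
  generalize ((n / 2 : ℕ) : ℤ) = m at *
  generalize ∑ i ∈ Finset.range n, |(i : ℤ) - m| = D at *
  have hn' : (2 : ℤ) ≤ n := by exact_mod_cast hn
  generalize (n : ℤ) = k at *
  have h4 : k ^ 2 ≤ 16 * D := by nlinarith
  constructor
  · nlinarith
  · nlinarith

lemma aux_rpow (a : ℝ) (ha : 0 ≤ a) (n : ℕ) :
    (a * (n : ℝ) ^ 3) ^ ((2 : ℝ) / 3) = a ^ ((2 : ℝ) / 3) * (n : ℝ) ^ 2 := by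
  rw [Real.mul_rpow ha (by positivity), ← Real.rpow_natCast, ← Real.rpow_mul (by positivity),
    ← Real.rpow_natCast]
  norm_num

/-- **Fixed density, fixed per-node sensing energy, growing coverage**
(Theorem 4, second part): the total information scales as `Θ(E_t^{2/3})` in the
total consumed energy, and the total energy tends to infinity. -/
theorem fixed_density_information_vs_energy
    (Es Ec 𝒦 : ℝ) (hEs : 0 ≤ Es) (hEc : 0 < Ec) (hK : 0 < 𝒦)
    (H It Et : ℕ → ℝ)
    (hH : ∀ n : ℕ, H n =
      ((∑ i ∈ Finset.range n, ∑ j ∈ Finset.range n,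
        (|(i : ℤ) - ((n / 2 : ℕ) : ℤ)| + |(j : ℤ) - ((n / 2 : ℕ) : ℤ)|) : ℤ) : ℝ))
    (hIt : ∀ n : ℕ, It n = (n : ℝ) ^ 2 * 𝒦)
    (hEt : ∀ n : ℕ, Et n = (n : ℝ) ^ 2 * Es + Ec * H n) :
    (∃ c₁ > (0 : ℝ), ∃ c₂ > (0 : ℝ), ∃ N : ℕ, ∀ n ≥ N,
      c₁ * Et n ^ ((2 : ℝ) / 3) ≤ It n ∧ It n ≤ c₂ * Et n ^ ((2 : ℝ) / 3)) ∧
    Tendsto Et atTop atTop := by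
  have hHb : ∀ n : ℕ, 2 ≤ n → (n : ℝ) ^ 3 ≤ 8 * H n ∧ H n ≤ 2 * (n : ℝ) ^ 3 := by
    intro n hn
    have hb := aux_bounds n hn
    rw [← aux_sum] at hb
    rw [hH n]
    exact ⟨by exact_mod_cast hb.1, by exact_mod_cast hb.2⟩
  have hlo : ∀ n : ℕ, 2 ≤ n → Ec / 8 * (n : ℝ) ^ 3 ≤ Et n := by
    intro n hn
    rw [hEt]
    have := mul_le_mul_of_nonneg_left (hHb n hn).1 hEc.le
    have h2 : 0 ≤ (n : ℝ) ^ 2 * Es := by positivity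
    linarith
  have hup : ∀ n : ℕ, 2 ≤ n → Et n ≤ (Es + 2 * Ec) * (n : ℝ) ^ 3 := by
    intro n hn
    rw [hEt]
    have := mul_le_mul_of_nonneg_left (hHb n hn).2 hEc.le
    have h1 : (1 : ℝ) ≤ n := by exact_mod_cast (by omega : 1 ≤ n)
    have h2 : (n : ℝ) ^ 2 ≤ (n : ℝ) ^ 3 := pow_le_pow_right₀ h1 (by norm_num)
    have h3 := mul_le_mul_of_nonneg_right h2 hEs
    linarith
  have hb : 0 < Es + 2 * Ec := by positivity
  have ha : 0 < Ec / 8 := by positivity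
  have hbp := Real.rpow_pos_of_pos hb ((2 : ℝ) / 3)
  have hap := Real.rpow_pos_of_pos ha ((2 : ℝ) / 3)
  refine ⟨⟨𝒦 / (Es + 2 * Ec) ^ ((2 : ℝ) / 3), by positivity,
    𝒦 / (Ec / 8) ^ ((2 : ℝ) / 3), by positivity, 2, fun n hn => ?_⟩, ?_⟩
  · have h0 : 0 ≤ Ec / 8 * (n : ℝ) ^ 3 := by positivity
    have e1 := Real.rpow_le_rpow h0 (hlo n hn) (by norm_num : (0 : ℝ) ≤ 2 / 3)
    have e2 := Real.rpow_le_rpow (h0.trans (hlo n hn)) (hup n hn) (by norm_num : (0 : ℝ) ≤ 2 / 3)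
    rw [aux_rpow _ ha.le] at e1
    rw [aux_rpow _ hb.le] at e2
    rw [hIt, div_mul_eq_mul_div, div_mul_eq_mul_div, div_le_iff₀ hbp, le_div_iff₀ hap]
    constructor
    · have := mul_le_mul_of_nonneg_left e2 hK.le
      linarith
    · have := mul_le_mul_of_nonneg_left e1 hK.le
      linarith
  · have ht : Tendsto (fun n : ℕ => Ec / 8 * (n : ℝ) ^ 3) atTop atTop :=
      Tendsto.const_mul_atTop ha
        ((tendsto_pow_atTop (by norm_num)).comp tendsto_natCast_atTop_atTop)
    refine tendsto_atTop_mono' _ ?_ ht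
    filter_upwards [eventually_ge_atTop 2] with n hn using hlo n hn
end
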